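/- arXiv:math/0501409 — 3 statements merged into one kernel-verified Lean document; each statement's English description precedes it below -/
import Mathlib

section
/- Let G be a finite group and M a G-module which, as a ℤ-module, is free of finite rank. Then the natural restriction map (M^∨)^G → (M^G)^∨, sending a G-invariant homomorphism φ : M → ℤ to its restriction to the invariant submodule M^G, is injective and has finite cokernel. -/
/-- The norm map `x ↦ ∑ g, g • x` of a finite group `G` acting additively on `M`, with values
in any submodule `MG` whose elements are exactly the `G`-invariants. -/
noncomputable def normMapToInvariants {G : Type*} [Group G] [Fintype G]
    {M : Type*} [AddCommGroup M] [DistribMulAction G M]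
    (MG : Submodule ℤ M) (hMG : ∀ x : M, x ∈ MG ↔ ∀ g : G, g • x = x) : M →ₗ[ℤ] MG where
  toFun x := ⟨∑ g : G, g • x, (hMG _).2 fun h => by
    rw [Finset.smul_sum]
    simp_rw [smul_smul]
    exact Fintype.sum_equiv (Equiv.mulLeft h) _ _ fun _ => rfl⟩
  map_add' x y := by
    ext
    simp [Finset.sum_add_distrib]
  map_smul' c x := by
    ext
    have h (g : G) : g • c • x = c • g • x :=
      map_zsmul (DistribSMul.toAddMonoidHom M g) c x
    simp [h, Finset.smul_sum]

/-- Let `G` be a finite group and `M` a `G`-module which is free of finite rank over `ℤ`.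
Then the natural restriction map `(M^∨)^G → (M^G)^∨`, sending a `G`-invariant
homomorphism `φ : M → ℤ` to its restriction to the submodule `M^G` of `G`-invariants,
is injective with finite cokernel.
Here `MG = M^G` (resp. `DG = (M^∨)^G`, the `G`-invariant functionals) is any submodule
whose membership predicate is `G`-invariance, and `res` is any linear map acting as the
restriction `φ ↦ φ|_{M^G}`. -/
theorem statement11 {G : Type*} [Group G] [Finite G]
    {M : Type*} [AddCommGroup M] [Module ℤ M] [Module.Free ℤ M] [Module.Finite ℤ M]
    [DistribMulAction G M]
    (MG : Submodule ℤ M) (hMG : ∀ x : M, x ∈ MG ↔ ∀ g : G, g • x = x)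
    (DG : Submodule ℤ (Module.Dual ℤ M))
    (hDG : ∀ φ : Module.Dual ℤ M, φ ∈ DG ↔ ∀ (g : G) (x : M), φ (g • x) = φ x)
    (res : ↥DG →ₗ[ℤ] Module.Dual ℤ ↥MG)
    (hres : ∀ (φ : ↥DG) (x : ↥MG), res φ x = (φ : Module.Dual ℤ M) (x : M)) :
    Function.Injective res ∧ Finite ((Module.Dual ℤ ↥MG) ⧸ LinearMap.range res) := by
  obtain rfl : ‹Module ℤ M› = AddCommGroup.toIntModule M := Subsingleton.elim _ _
  cases nonempty_fintype G
  have hcard : (Fintype.card G : ℤ) ≠ 0 := by exact_mod_cast Fintype.card_ne_zero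
  let N := normMapToInvariants MG hMG
  have hN (x : M) : (N x : M) = ∑ g : G, g • x := rfl
  constructor
  · refine (injective_iff_map_eq_zero res).2 fun φ hφ => Subtype.ext (LinearMap.ext fun x => ?_)
    have h := hres φ (N x)
    rw [hφ, hN, map_sum, Finset.sum_congr rfl fun g _ => (hDG φ).1 φ.2 g x] at h
    simpa using h
  · refine Module.finite_of_fg_torsion _ fun q => ?_
    obtain ⟨ψ, rfl⟩ := Submodule.Quotient.mk_surjective _ q
    refine ⟨⟨Fintype.card G, mem_nonZeroDivisors_of_ne_zero hcard⟩, ?_⟩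
    have hinv : ψ ∘ₗ N ∈ DG := (hDG _).2 fun g x => by
      refine congrArg ψ (Subtype.ext ?_)
      simp_rw [hN, smul_smul]
      exact Fintype.sum_equiv (Equiv.mulRight g) _ _ fun _ => rfl
    change (Fintype.card G : ℤ) • Submodule.Quotient.mk (p := LinearMap.range res) ψ = 0
    rw [← Submodule.Quotient.mk_smul, Submodule.Quotient.mk_eq_zero]
    refine ⟨⟨ψ ∘ₗ N, hinv⟩, LinearMap.ext fun x => ?_⟩
    have hNx : N x = Fintype.card G • x := by
      ext
      rw [hN, Finset.sum_congr rfl fun g _ => (hMG x).1 x.2 g]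
      simp
    rw [hres]
    simp [hNx]
end

section
/- Let G be a finite group and M a G-module which, as a ℤ-module, is free of finite rank. Then there exists a short exact sequence of G-modules 0 → M → P → Q → 0 in which P and Q are free of finite rank as ℤ-modules and P is a permutation G-module, i.e., P admits a ℤ-basis that is permuted by the action of G. Equivalently: there exist a finite G-set S and an injective G-equivariant ℤ-linear map M → ℤ[S] (the free ℤ-module on S with the permutation action of G) whose cokernel is a free ℤ-module of finite rank. -/
/-- Over a principal ideal domain, the cokernel of a split injection into a finite free module is free. -/
theorem Module.Free.quotient_range_of_leftInverse {R M N : Type*} [CommRing R] [IsDomain R]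
    [IsPrincipalIdealRing R] [AddCommGroup M] [AddCommGroup N] [Module R M] [Module R N]
    [Module.Free R N] [Module.Finite R N] (f : M →ₗ[R] N) (p : N →ₗ[R] M) (h : Function.LeftInverse p f) :
    Module.Free R (N ⧸ LinearMap.range f) := by
  have hle : LinearMap.range f ≤ LinearMap.ker (LinearMap.id - f ∘ₗ p) := by
    rintro _ ⟨x, rfl⟩
    simp [h x]
  have hinj : Function.Injective
      ((LinearMap.range f).liftQ (LinearMap.id - f ∘ₗ p) hle) := by
    refine LinearMap.ker_eq_bot.mp (Submodule.ker_liftQ_eq_bot _ _ hle fun y hy => ?_)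
    exact ⟨p y, (sub_eq_zero.mp (by simpa using hy)).symm⟩
  exact Module.Free.of_equiv (LinearEquiv.ofInjective _ hinj).symm

/-- Let `G` be a finite group and `M` a `G`-module which, as a `ℤ`-module, is free of
finite rank. Then `M` embeds `G`-equivariantly into a permutation `G`-module with
`ℤ`-free cokernel of finite rank: there exist a finite `G`-set `S` (given by a
permutation representation `σ : G →* Equiv.Perm S`) and an injective `G`-equivariant
`ℤ`-linear map `f : M → ℤ[S]` (where `G` acts on the free module `ℤ[S] = S →₀ ℤ` by
permuting the basis, i.e. via `Finsupp.mapDomain (σ g)`) whose cokernel is a free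
`ℤ`-module of finite rank.  This is the existence of a short exact sequence of
`G`-modules `0 → M → P → Q → 0` with `P` a permutation module and `P`, `Q` free of
finite rank over `ℤ`. -/
theorem statement12 {G : Type*} [Group G] [Finite G]
    {M : Type*} [AddCommGroup M] [Module ℤ M] [Module.Free ℤ M] [Module.Finite ℤ M]
    [DistribMulAction G M] :
    ∃ (S : Type) (_ : Fintype S) (σ : G →* Equiv.Perm S) (f : M →ₗ[ℤ] (S →₀ ℤ)),
      Function.Injective f ∧
      (∀ (g : G) (x : M), f (g • x) = Finsupp.mapDomain (σ g) (f x)) ∧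
      Module.Free ℤ ((S →₀ ℤ) ⧸ LinearMap.range f) ∧
      Module.Finite ℤ ((S →₀ ℤ) ⧸ LinearMap.range f) := by
  obtain ⟨n, ⟨e⟩⟩ := Finite.exists_equiv_fin G
  let b := Module.finBasis ℤ M
  let σ : G →* Equiv.Perm (Fin n × Fin (Module.finrank ℤ M)) :=
    { toFun := fun g => (e.permCongr (Equiv.mulLeft g)).prodCongr (Equiv.refl _)
      map_one' := by ext s <;> simp
      map_mul' := fun g h => by ext s <;> simp }
  have hσ (g : G) (s) : (σ g).symm s = (e (g⁻¹ * e.symm s.1), s.2) := by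
    rw [Equiv.symm_apply_eq]
    simp [σ]
  let act (g : G) : M →ₗ[ℤ] M :=
    { toFun := fun x => g • x
      map_add' := smul_add g
      map_smul' := fun k x => by
        simpa using map_intCast_smul (DistribSMul.toAddMonoidHom M g) ℤ ℤ k x }
  let f : M →ₗ[ℤ] (Fin n × Fin (Module.finrank ℤ M) →₀ ℤ) :=
    (Finsupp.linearEquivFunOnFinite ℤ ℤ _).symm.toLinearMap ∘ₗ
      LinearMap.pi fun s => b.coord s.2 ∘ₗ act (e.symm s.1)⁻¹
  have hf (x : M) (s) : f x s = b.repr ((e.symm s.1)⁻¹ • x) s.2 := rfl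
  let p : (Fin n × Fin (Module.finrank ℤ M) →₀ ℤ) →ₗ[ℤ] M :=
    ∑ i, LinearMap.toSpanSingleton ℤ M (b i) ∘ₗ Finsupp.lapply (e 1, i)
  have hp : Function.LeftInverse p f := fun x => by
    simp [p, hf, b.sum_repr]
  refine ⟨_, inferInstance, σ, f, hp.injective, fun g x => ?_,
    Module.Free.quotient_range_of_leftInverse f p hp, inferInstance⟩
  ext s
  rw [← Finsupp.equivMapDomain_eq_mapDomain, Finsupp.equivMapDomain_apply, hσ, hf, hf]
  simp [mul_smul]
end

section
/- Let ι be a countable index set, t ≥ 1 an integer, and H : ι → ℝ a function with H(x) ≥ 1 for all x ∈ ι, such that for every real B the number n(B) := card{x ∈ ι : H(x) ≤ B} is finite. Assume that the series ζ(s) := Σ_{x∈ι} H(x)^{-s} converges absolutely for every complex s with Re(s) > 1, and that there exist ε > 0 and a holomorphic function g on {s ∈ ℂ : Re(s) > 1 − ε} such that g(s) = (s−1)^t·ζ(s) for Re(s) > 1 and g(1) ≠ 0. Then, as B → +∞, n(B) ∼ (g(1)/(t−1)!) · B·(log B)^{t−1}. -/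
open Filter Asymptotics

namespace Delange

open MeasureTheory Set Topology SchwartzMap FourierTransform
open scoped Real ContDiff

lemma integrableOn_pow_mul_exp_neg_mul (n : ℕ) {δ : ℝ} (hδ : 0 < δ) :
    IntegrableOn (fun u : ℝ => u ^ n * Real.exp (-(δ * u))) (Ioi 0) := by
  have h := integrableOn_rpow_mul_exp_neg_mul_rpow (p := 1) (s := n) (b := δ)
    (by have := n.cast_nonneg (α := ℝ); linarith) one_pos hδ
  refine h.congr_fun (fun u _ => ?_) measurableSet_Ioi
  simp

lemma tendsto_pow_mul_exp_neg_mul (n : ℕ) {δ : ℝ} (hδ : 0 < δ) :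
    Tendsto (fun u : ℝ => u ^ n * Real.exp (-(δ * u))) atTop (𝓝 0) := by
  have h := (Real.tendsto_pow_mul_exp_neg_atTop_nhds_zero n).comp (tendsto_id.const_mul_atTop hδ)
  have h2 := h.const_mul ((δ ^ n)⁻¹)
  rw [mul_zero] at h2
  refine h2.congr fun u => ?_
  have : δ ^ n ≠ 0 := by positivity
  simp only [Function.comp, id, mul_pow]
  field_simp

lemma norm_pow_mul_cexp (n : ℕ) (z : ℂ) {u : ℝ} (hu : 0 ≤ u) :
    ‖(u : ℂ) ^ n * Complex.exp (-(z * u))‖ = u ^ n * Real.exp (-(z.re * u)) := by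
  rw [norm_mul, norm_pow, Complex.norm_real, Real.norm_of_nonneg hu, Complex.norm_exp]
  simp

lemma integrableOn_pow_mul_cexp_neg_mul (n : ℕ) {z : ℂ} (hz : 0 < z.re) :
    IntegrableOn (fun u : ℝ => (u : ℂ) ^ n * Complex.exp (-(z * u))) (Ioi 0) := by
  refine (integrableOn_pow_mul_exp_neg_mul n hz).mono' ?_ ?_
  · exact (by fun_prop : Continuous fun u : ℝ =>
      (u : ℂ) ^ n * Complex.exp (-(z * u))).aestronglyMeasurable
  · filter_upwards [ae_restrict_mem measurableSet_Ioi] with u hu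
    rw [norm_pow_mul_cexp n z (le_of_lt hu)]

/-- The Laplace transform of a monomial. -/
lemma integral_pow_mul_cexp_neg_mul (n : ℕ) {z : ℂ} (hz : 0 < z.re) :
    ∫ u : ℝ in Ioi 0, (u : ℂ) ^ n * Complex.exp (-(z * u)) = n.factorial / z ^ (n + 1) := by
  have hz0 : z ≠ 0 := by rintro rfl; simp at hz
  have hexp (u : ℝ) : HasDerivAt (fun u : ℝ => Complex.exp (-(z * u)))
      (-z * Complex.exp (-(z * u))) u := by
    have h : HasDerivAt (fun u : ℝ => -(z * (u : ℂ))) (-z) u := by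
      simpa using ((Complex.ofRealCLM.hasDerivAt (x := u)).const_mul z).fun_neg
    simpa [mul_comm] using h.cexp
  have hlim (m : ℕ) : Tendsto (fun u : ℝ => (u : ℂ) ^ m * Complex.exp (-(z * u))) atTop (𝓝 0) := by
    rw [tendsto_zero_iff_norm_tendsto_zero]
    refine (tendsto_pow_mul_exp_neg_mul m hz).congr' ?_
    filter_upwards [eventually_ge_atTop 0] with u hu
    rw [norm_pow_mul_cexp m z hu]
  induction n with
  | zero =>
    have h := integral_Ioi_of_hasDerivAt_of_tendsto (a := 0) (m := 0)
      (f := fun u : ℝ => -z⁻¹ * Complex.exp (-(z * u)))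
      (f' := fun u : ℝ => (u : ℂ) ^ 0 * Complex.exp (-(z * u)))
      (by fun_prop) (fun u _ => ?_) (integrableOn_pow_mul_cexp_neg_mul 0 hz) ?_
    · rw [h]; simp
    · refine ((hexp u).const_mul (-z⁻¹)).congr_deriv ?_
      field_simp
    · simpa using (hlim 0).const_mul (-z⁻¹)
  | succ n ih =>
    have h := integral_Ioi_of_hasDerivAt_of_tendsto (a := 0) (m := 0)
      (f := fun u : ℝ => (u : ℂ) ^ (n + 1) * Complex.exp (-(z * u)))
      (f' := fun u : ℝ => (n + 1 : ℂ) * ((u : ℂ) ^ n * Complex.exp (-(z * u)))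
        - z * ((u : ℂ) ^ (n + 1) * Complex.exp (-(z * u))))
      (by fun_prop) (fun u _ => ?_)
      (((integrableOn_pow_mul_cexp_neg_mul n hz).const_mul _).sub
        ((integrableOn_pow_mul_cexp_neg_mul (n + 1) hz).const_mul _)) (hlim (n + 1))
    · rw [integral_sub ((integrableOn_pow_mul_cexp_neg_mul n hz).const_mul _)
        ((integrableOn_pow_mul_cexp_neg_mul (n + 1) hz).const_mul _), integral_const_mul,
        integral_const_mul, ih] at h
      simp only [Complex.ofReal_zero, ne_eq, Nat.add_eq_zero_iff, one_ne_zero, and_false,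
        not_false_eq_true, zero_pow, zero_mul, sub_zero, sub_eq_zero] at h
      rw [← mul_right_inj' hz0, ← h, Nat.factorial_succ]
      push_cast
      field_simp
      ring
    · have hp : HasDerivAt (fun u : ℝ => (u : ℂ) ^ (n + 1)) ((n + 1 : ℂ) * (u : ℂ) ^ n) u := by
        simpa using (Complex.ofRealCLM.hasDerivAt (x := u)).fun_pow (n + 1)
      refine (hp.mul (hexp u)).congr_deriv ?_
      ring

lemma fourier_apply_sub (φ : 𝓢(ℝ, ℂ)) (u v : ℝ) :
    𝓕 φ (u - v) = ∫ y : ℝ, φ y * Complex.exp (↑(2 * π * v * y) * Complex.I)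
      * Complex.exp (-(2 * π * y * u * Complex.I)) := by
  rw [SchwartzMap.fourier_coe, Real.fourier_real_eq_integral_exp_smul]
  refine integral_congr_ae (ae_of_all _ fun y => ?_)
  simp only [smul_eq_mul]
  rw [mul_assoc (φ y), ← Complex.exp_add, mul_comm]
  congr 2
  push_cast
  ring

/-- The contribution of a pole of order `n + 1`, expressed through the Fourier transform. -/
lemma integral_phase_div_pow (φ : 𝓢(ℝ, ℂ)) (n : ℕ) (v : ℝ) {δ : ℝ} (hδ : 0 < δ) :
    ∫ y : ℝ, φ y * Complex.exp (↑(2 * π * v * y) * Complex.I)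
        * (1 / (δ + 2 * π * y * Complex.I) ^ (n + 1)) =
      1 / n.factorial * ∫ u : ℝ in Ioi 0,
        (u : ℂ) ^ n * Complex.exp (-(δ * u)) * 𝓕 φ (u - v) := by
  have hre (y : ℝ) : (δ + 2 * π * y * Complex.I : ℂ).re = δ := by simp
  have hn : (n.factorial : ℂ) ≠ 0 := by exact_mod_cast n.factorial_ne_zero
  have hswap := integral_integral_swap (μ := volume) (ν := volume.restrict (Ioi (0 : ℝ)))
    (f := fun y u : ℝ => φ y * Complex.exp (↑(2 * π * v * y) * Complex.I)
      * ((u : ℂ) ^ n * Complex.exp (-((δ + 2 * π * y * Complex.I) * u)))) ?_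
  · calc
      _ = ∫ y : ℝ, 1 / n.factorial * ∫ u : ℝ in Ioi 0,
            φ y * Complex.exp (↑(2 * π * v * y) * Complex.I)
            * ((u : ℂ) ^ n * Complex.exp (-((δ + 2 * π * y * Complex.I) * u))) := by
        refine integral_congr_ae (ae_of_all _ fun y => ?_)
        simp only
        rw [integral_const_mul, integral_pow_mul_cexp_neg_mul n (by rw [hre]; exact hδ)]
        field_simp
      _ = _ := by
        rw [integral_const_mul, hswap]
        congr 1
        refine integral_congr_ae (ae_of_all _ fun u => ?_)
        simp only
        rw [fourier_apply_sub, ← integral_const_mul]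
        refine integral_congr_ae (ae_of_all _ fun y => ?_)
        simp only
        rw [show -((δ + 2 * π * y * Complex.I) * u) =
          -(δ * u : ℂ) + -(2 * π * y * u * Complex.I) by ring, Complex.exp_add]
        ring
  · have h := (φ.integrable (μ := volume)).norm.mul_prod (integrableOn_pow_mul_exp_neg_mul n hδ)
    refine h.mono' ?_ ?_
    · refine Continuous.aestronglyMeasurable ?_
      have := φ.continuous
      simp only [Function.uncurry_def]
      fun_prop
    · have h2 : ∀ᵐ p : ℝ × ℝ ∂(volume.prod (volume.restrict (Ioi (0 : ℝ)))), p.2 ∈ Ioi (0 : ℝ) :=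
        Measure.quasiMeasurePreserving_snd.ae (ae_restrict_mem measurableSet_Ioi)
      filter_upwards [h2] with p hp
      simp only [Function.uncurry_def]
      rw [norm_mul, norm_mul, Complex.norm_exp_ofReal_mul_I, mul_one,
        norm_pow_mul_cexp n _ (le_of_lt hp), hre]

lemma integrable_pow_mul_fourier_sub (φ : 𝓢(ℝ, ℂ)) (n : ℕ) (v : ℝ) :
    Integrable fun u : ℝ => (u : ℂ) ^ n * 𝓕 φ (u - v) := by
  have h1 (w : ℝ) : ‖w + v‖ ^ n * ‖𝓕 φ w‖ ≤
      2 ^ (n - 1) * (‖w‖ ^ n * ‖𝓕 φ w‖ + ‖v‖ ^ n * ‖𝓕 φ w‖) := by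
    rw [← add_mul, ← mul_assoc]
    gcongr
    exact (pow_le_pow_left₀ (norm_nonneg _) (norm_add_le w v) n).trans
      (add_pow_le (norm_nonneg _) (norm_nonneg _) n)
  have h2 : Integrable fun w : ℝ => ((w + v : ℝ) : ℂ) ^ n * 𝓕 φ w := by
    refine ((((𝓕 φ).integrable_pow_mul volume n).add
      (((𝓕 φ).integrable (μ := volume)).norm.const_mul (‖v‖ ^ n))).const_mul (2 ^ (n - 1))).mono'
      ?_ (ae_of_all _ fun w => ?_)
    · have := (𝓕 φ).continuous
      exact Continuous.aestronglyMeasurable (by fun_prop)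
    · rw [norm_mul, norm_pow, Complex.norm_real]
      exact h1 w
  simpa using h2.comp_sub_right v

lemma tendsto_integral_pow_mul_exp_mul_fourier (φ : 𝓢(ℝ, ℂ)) (n : ℕ) (v : ℝ) :
    Tendsto (fun δ : ℝ => ∫ u : ℝ in Ioi 0, (u : ℂ) ^ n * Complex.exp (-(δ * u)) * 𝓕 φ (u - v))
      (𝓝[>] 0) (𝓝 (∫ u : ℝ in Ioi 0, (u : ℂ) ^ n * 𝓕 φ (u - v))) := by
  refine tendsto_integral_filter_of_dominated_convergence
    (fun u => ‖(u : ℂ) ^ n * 𝓕 φ (u - v)‖) ?_ ?_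
    (integrable_pow_mul_fourier_sub φ n v).norm.integrableOn ?_
  · have := (𝓕 φ).continuous
    exact Eventually.of_forall fun δ => Continuous.aestronglyMeasurable (by fun_prop)
  · filter_upwards [self_mem_nhdsWithin] with δ hδ
    filter_upwards [ae_restrict_mem measurableSet_Ioi] with u hu
    rw [mul_right_comm, norm_mul _ (Complex.exp _)]
    refine mul_le_of_le_one_right (norm_nonneg _) ?_
    rw [Complex.norm_exp]
    have : 0 ≤ δ * u := mul_nonneg (le_of_lt hδ) (le_of_lt hu)
    simpa using this
  · refine ae_of_all _ fun u => ?_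
    have hc : Continuous fun δ : ℝ => (u : ℂ) ^ n * Complex.exp (-(δ * u)) * 𝓕 φ (u - v) := by
      fun_prop
    have := (hc.tendsto 0).mono_left (nhdsWithin_le_nhds (s := Ioi 0))
    simpa using this

lemma tendsto_integral_pow_mul_fourier_div (φ : 𝓢(ℝ, ℂ)) (n : ℕ) :
    Tendsto (fun v : ℝ => (∫ u : ℝ in Ioi 0, (u : ℂ) ^ n * 𝓕 φ (u - v)) / (v : ℂ) ^ n)
      atTop (𝓝 (∫ w, 𝓕 φ w)) := by
  have hcov (v : ℝ) : (∫ u : ℝ in Ioi 0, (u : ℂ) ^ n * 𝓕 φ (u - v)) / (v : ℂ) ^ n =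
      ∫ w : ℝ, (Ioi (-v)).indicator (fun w : ℝ => (((w + v) / v : ℝ) : ℂ) ^ n * 𝓕 φ w) w := by
    rw [← integral_indicator measurableSet_Ioi, ← integral_add_right_eq_self _ v,
      ← integral_div]
    refine integral_congr_ae (ae_of_all _ fun w => ?_)
    by_cases hw : -v < w
    · have h1 : w + v ∈ Ioi (0 : ℝ) := by simp only [mem_Ioi]; linarith
      simp only [indicator_of_mem h1, indicator_of_mem (show w ∈ Ioi (-v) from hw)]
      push_cast
      rw [add_sub_cancel_right, div_pow]
      ring
    · have h1 : w + v ∉ Ioi (0 : ℝ) := by simp only [mem_Ioi]; linarith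
      simp only [indicator_of_notMem h1, indicator_of_notMem (show w ∉ Ioi (-v) from hw), zero_div]
  simp_rw [hcov]
  refine tendsto_integral_filter_of_dominated_convergence
    (fun w => 2 ^ (n - 1) * (‖w‖ ^ n * ‖𝓕 φ w‖ + 1 ^ n * ‖𝓕 φ w‖)) ?_ ?_ ?_ ?_
  · have := (𝓕 φ).continuous
    exact Eventually.of_forall fun v =>
      (Continuous.aestronglyMeasurable (by fun_prop)).indicator measurableSet_Ioi
  · filter_upwards [eventually_ge_atTop 1] with v hv
    refine ae_of_all _ fun w => (norm_indicator_le_norm_self _ _).trans ?_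
    rw [norm_mul, norm_pow, Complex.norm_real, ← add_mul, ← mul_assoc]
    gcongr
    refine (pow_le_pow_left₀ (norm_nonneg _) ?_ n).trans
      (add_pow_le (norm_nonneg w) zero_le_one n)
    rw [add_div, div_self (by linarith)]
    refine (norm_add_le _ _).trans ?_
    rw [norm_one, norm_div, Real.norm_of_nonneg (by linarith : 0 ≤ v)]
    gcongr
    exact div_le_self (norm_nonneg _) hv
  · exact (((𝓕 φ).integrable_pow_mul volume n).add
      (((𝓕 φ).integrable (μ := volume)).norm.const_mul (1 ^ n))).const_mul (2 ^ (n - 1))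
  · refine ae_of_all _ fun w => ?_
    have h1 : Tendsto (fun v : ℝ => (w + v) / v) atTop (𝓝 1) := by
      have h := (tendsto_const_nhds (x := w)).div_atTop tendsto_id
      have h2 := h.add_const 1
      rw [zero_add] at h2
      refine h2.congr' ?_
      filter_upwards [eventually_gt_atTop 0] with v hv
      simp only [id]
      field_simp
    have h2 : Tendsto (fun v : ℝ => (((w + v) / v : ℝ) : ℂ) ^ n * 𝓕 φ w) atTop
        (𝓝 (𝓕 φ w)) := by
      have := (((Complex.continuous_ofReal.tendsto 1).comp h1).pow n).mul_const (𝓕 φ w)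
      simpa using this
    refine h2.congr' ?_
    filter_upwards [eventually_gt_atTop (-w)] with v hv
    rw [indicator_of_mem]
    simp only [mem_Ioi]; linarith

lemma integrable_phase_mul (φ : 𝓢(ℝ, ℂ)) (hφ : HasCompactSupport φ) (v : ℝ) {δ : ℝ} (hδ : 0 < δ)
    {G : ℂ → ℂ} (hG : ContinuousOn G {z | 0 < z.re}) :
    Integrable fun y : ℝ => φ y * Complex.exp (↑(2 * π * v * y) * Complex.I)
      * G (δ + 2 * π * y * Complex.I) := by
  have hc := φ.continuous
  have hG' : Continuous fun y : ℝ => G (δ + 2 * π * y * Complex.I) :=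
    hG.comp_continuous (by fun_prop) fun y => by simpa using hδ
  refine Continuous.integrable_of_hasCompactSupport (.mul (by fun_prop) hG') ?_
  exact (hφ.mul_right).mul_right

lemma tendsto_integral_phase_mul (φ : 𝓢(ℝ, ℂ)) (hφ : HasCompactSupport φ) (v : ℝ)
    {ε : ℝ} (hε : 0 < ε) {G : ℂ → ℂ} (hG : ContinuousOn G {z | -ε < z.re}) :
    Tendsto (fun δ : ℝ => ∫ y : ℝ, φ y * Complex.exp (↑(2 * π * v * y) * Complex.I)
      * G (δ + 2 * π * y * Complex.I)) (𝓝[>] 0)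
      (𝓝 (∫ y : ℝ, φ y * Complex.exp (↑(2 * π * v * y) * Complex.I)
        * G (2 * π * y * Complex.I))) := by
  have hc := φ.continuous
  have h := continuousOn_integral_of_compact_support (μ := volume) (s := Ioi (-ε))
    (k := tsupport φ) (f := fun δ y : ℝ => φ y * Complex.exp (↑(2 * π * v * y) * Complex.I)
      * G (δ + 2 * π * y * Complex.I)) hφ ?_ ?_
  · have h0 := (h 0 (by simpa using hε)).continuousAt (Ioi_mem_nhds (by simpa using hε))
    simpa using h0.tendsto.mono_left (nhdsWithin_le_nhds (s := Ioi 0))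
  · refine ContinuousOn.mul (Continuous.continuousOn (by fun_prop)) ?_
    refine hG.comp (Continuous.continuousOn (by fun_prop)) fun p hp => ?_
    simpa using hp.1
  · intro δ y _ hy
    rw [image_eq_zero_of_notMem_tsupport hy, zero_mul, zero_mul]

lemma tendsto_phase_zero (f : ℝ → ℂ) :
    Tendsto (fun v : ℝ => ∫ y : ℝ, f y * Complex.exp (↑(2 * π * v * y) * Complex.I)) atTop
      (𝓝 0) := by
  have h := (Real.zero_at_infty_fourier f).comp
    (tendsto_neg_atTop_atBot.mono_right atBot_le_cocompact)
  refine h.congr fun v => ?_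
  simp only [Function.comp]
  rw [Real.fourier_real_eq_integral_exp_smul]
  refine integral_congr_ae (ae_of_all _ fun y => ?_)
  simp only [smul_eq_mul]
  rw [mul_comm]
  congr 3
  push_cast
  ring

/-- Boundary behaviour of the smoothed integral of a function with a pole of order `t` at `0`. -/
lemma exists_tendsto_integral_phase_div_pow (φ : 𝓢(ℝ, ℂ)) (hφ : HasCompactSupport φ)
    {ε : ℝ} (hε : 0 < ε) (t : ℕ) :
    ∀ G : ℂ → ℂ, DifferentiableOn ℂ G {z | -ε < z.re} → ∃ R : ℝ → ℂ,
      (∀ v : ℝ, Tendsto (fun δ : ℝ => ∫ y : ℝ, φ y * Complex.exp (↑(2 * π * v * y) * Complex.I)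
        * (G (δ + 2 * π * y * Complex.I) / (δ + 2 * π * y * Complex.I) ^ t))
        (𝓝[>] 0) (𝓝 (R v))) ∧
      Tendsto (fun v : ℝ => R v / (v : ℂ) ^ t) atTop (𝓝 0) ∧
      ∀ n, t = n + 1 → Tendsto (fun v : ℝ => R v / (v : ℂ) ^ n) atTop
        (𝓝 (G 0 / n.factorial * ∫ w, 𝓕 φ w)) := by
  have hU : {z : ℂ | -ε < z.re} ∈ 𝓝 (0 : ℂ) :=
    (isOpen_lt continuous_const Complex.continuous_re).mem_nhds (by simpa using hε)
  induction t with
  | zero =>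
    intro G hG
    refine ⟨fun v => ∫ y : ℝ, φ y * Complex.exp (↑(2 * π * v * y) * Complex.I)
      * G (2 * π * y * Complex.I), fun v => ?_, ?_, by simp⟩
    · simpa using tendsto_integral_phase_mul φ hφ v hε hG.continuousOn
    · simp only [pow_zero, div_one]
      refine (tendsto_phase_zero fun y => φ y * G (2 * π * y * Complex.I)).congr fun v => ?_
      refine integral_congr_ae (ae_of_all _ fun y => ?_)
      ring
  | succ n ih =>
    intro G hG
    have hG1 := (Complex.differentiableOn_dslope hU).2 hG
    obtain ⟨R, hR, hR0, -⟩ := ih _ hG1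
    have hmain : Tendsto (fun v : ℝ => (G 0 * (1 / n.factorial *
        ∫ u : ℝ in Ioi 0, (u : ℂ) ^ n * 𝓕 φ (u - v)) + R v) / (v : ℂ) ^ n) atTop
        (𝓝 (G 0 / n.factorial * ∫ w, 𝓕 φ w)) := by
      have h := ((tendsto_integral_pow_mul_fourier_div φ n).const_mul
        (G 0 / n.factorial)).add hR0
      rw [add_zero] at h
      refine h.congr fun v => ?_
      ring
    refine ⟨fun v => G 0 * (1 / n.factorial *
      ∫ u : ℝ in Ioi 0, (u : ℂ) ^ n * 𝓕 φ (u - v)) + R v, fun v => ?_, ?_, ?_⟩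
    · refine ((((tendsto_integral_pow_mul_exp_mul_fourier φ n v).const_mul
        (1 / n.factorial : ℂ)).const_mul (G 0)).add (hR v)).congr' ?_
      filter_upwards [self_mem_nhdsWithin] with δ hδ
      have hδ : 0 < δ := hδ
      have hsub : {z : ℂ | 0 < z.re} ⊆ {z | -ε < z.re} := fun z hz => by
        have : 0 < z.re := hz
        show -ε < z.re
        linarith
      have hne : ∀ z ∈ {z : ℂ | 0 < z.re}, z ≠ 0 := fun z hz h => by simp [h] at hz
      rw [← integral_phase_div_pow φ n v hδ, ← integral_const_mul, ← integral_add]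
      · refine integral_congr_ae (ae_of_all _ fun y => ?_)
        have hz := hne (δ + 2 * π * y * Complex.I) (by simpa using hδ)
        have hd := sub_smul_dslope G 0 (δ + 2 * π * y * Complex.I)
        simp only [sub_zero, smul_eq_mul] at hd
        simp only
        rw [eq_sub_iff_add_eq] at hd
        rw [← hd]
        generalize (δ + 2 * π * y * Complex.I : ℂ) = z at hz
        field_simp
        ring
      · refine (integrable_phase_mul φ hφ v hδ (G := fun z => 1 / z ^ (n + 1)) ?_).const_mul _
        exact continuousOn_const.div (by fun_prop) fun z hz => pow_ne_zero _ (hne z hz)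
      · refine integrable_phase_mul φ hφ v hδ (G := fun z => dslope G 0 z / z ^ n) ?_
        exact (hG1.continuousOn.mono hsub).div (by fun_prop) fun z hz => pow_ne_zero _ (hne z hz)
    · have hinv : Tendsto (fun v : ℝ => ((v⁻¹ : ℝ) : ℂ)) atTop (𝓝 0) := by
        have := (Complex.continuous_ofReal.tendsto 0).comp (tendsto_inv_atTop_zero (𝕜 := ℝ))
        rwa [Complex.ofReal_zero] at this
      have h := hmain.mul hinv
      rw [mul_zero] at h
      refine h.congr fun v => ?_
      push_cast
      rw [pow_succ, ← div_eq_mul_inv, div_div]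
    · rintro m hm
      obtain rfl : n = m := by omega
      exact hmain

section Series

variable {ι : Type*} {H : ι → ℝ}

lemma cpow_neg_eq (hH : ∀ x, 1 ≤ H x) (x : ι) (δ y : ℝ) :
    (H x : ℂ) ^ (-(1 + (δ + 2 * π * y * Complex.I))) =
      ((H x ^ (-(1 + δ)) : ℝ) : ℂ) *
        Complex.exp (-(2 * π * y * (Real.log (H x)) * Complex.I)) := by
  have h0 : 0 < H x := one_pos.trans_le (hH x)
  have h1 : (H x : ℂ) ≠ 0 := by exact_mod_cast h0.ne'
  rw [Complex.ofReal_cpow h0.le, Complex.cpow_def_of_ne_zero h1, Complex.cpow_def_of_ne_zero h1,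
    ← Complex.exp_add, Complex.ofReal_log h0.le]
  congr 1
  push_cast
  ring

lemma norm_cpow_neg_eq (hH : ∀ x, 1 ≤ H x) (x : ι) (δ y : ℝ) :
    ‖(H x : ℂ) ^ (-(1 + (δ + 2 * π * y * Complex.I)))‖ = H x ^ (-(1 + δ)) := by
  have h0 : 0 < H x := one_pos.trans_le (hH x)
  rw [Complex.norm_cpow_eq_rpow_re_of_pos h0]
  simp

lemma hasSum_rpow_mul_fourier [Countable ι] (hH : ∀ x, 1 ≤ H x)
    (hconv : ∀ s : ℂ, 1 < s.re → Summable fun x : ι => ‖(H x : ℂ) ^ (-s)‖)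
    (φ : 𝓢(ℝ, ℂ)) (v : ℝ) {δ : ℝ} (hδ : 0 < δ) :
    HasSum (fun x => ((H x ^ (-(1 + δ)) : ℝ) : ℂ) * 𝓕 φ (Real.log (H x) - v))
      (∫ y : ℝ, φ y * Complex.exp (↑(2 * π * v * y) * Complex.I)
        * ∑' x, (H x : ℂ) ^ (-(1 + (δ + 2 * π * y * Complex.I)))) := by
  have hc := φ.continuous
  have hnorm (x : ι) (y : ℝ) : ‖φ y * Complex.exp (↑(2 * π * v * y) * Complex.I)
      * (H x : ℂ) ^ (-(1 + (δ + 2 * π * y * Complex.I)))‖ = ‖φ y‖ * H x ^ (-(1 + δ)) := by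
    rw [norm_mul, norm_mul, Complex.norm_exp_ofReal_mul_I, mul_one, norm_cpow_neg_eq hH]
  have hsum : Summable fun x => H x ^ (-(1 + δ)) := by
    refine (hconv (1 + (δ + 2 * π * (0 : ℝ) * Complex.I)) (by simpa using hδ)).congr fun x => ?_
    rw [norm_cpow_neg_eq hH]
  have h := hasSum_integral_of_summable_integral_norm (μ := (volume : Measure ℝ))
    (F := fun (x : ι) (y : ℝ) => φ y * Complex.exp (↑(2 * π * v * y) * Complex.I)
      * (H x : ℂ) ^ (-(1 + (δ + 2 * π * y * Complex.I)))) (fun x => ?_) ?_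
  · simp_rw [tsum_mul_left] at h
    refine h.congr_fun fun x => ?_
    rw [fourier_apply_sub, ← integral_const_mul]
    refine integral_congr_ae (ae_of_all _ fun y => ?_)
    simp only
    rw [cpow_neg_eq hH]
    ring
  · refine ((φ.integrable (μ := volume)).norm.mul_const (H x ^ (-(1 + δ)))).mono' ?_
      (ae_of_all _ fun y => (hnorm x y).le)
    simp_rw [cpow_neg_eq hH]
    exact Continuous.aestronglyMeasurable (by fun_prop)
  · simp_rw [hnorm, integral_mul_const]
    exact hsum.mul_left _

lemma tendsto_rpow_neg (hH : ∀ x, 1 ≤ H x) (x : ι) :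
    Tendsto (fun δ : ℝ => H x ^ (-(1 + δ))) (𝓝[>] 0) (𝓝 (H x)⁻¹) := by
  have h0 : 0 < H x := one_pos.trans_le (hH x)
  have hc : Continuous fun δ : ℝ => H x ^ (-(1 + δ)) :=
    Real.continuous_const_rpow h0.ne' |>.comp (by fun_prop)
  have := (hc.tendsto 0).mono_left (nhdsWithin_le_nhds (s := Ioi 0))
  simpa [Real.rpow_neg_one] using this

variable {t : ℕ} {ε : ℝ} {g : ℂ → ℂ}

lemma exists_tendsto_smoothed_series [Countable ι] (hH : ∀ x, 1 ≤ H x)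
    (hconv : ∀ s : ℂ, 1 < s.re → Summable fun x : ι => ‖(H x : ℂ) ^ (-s)‖)
    (hε : 0 < ε) (hg : DifferentiableOn ℂ g {s : ℂ | 1 - ε < s.re})
    (hgζ : ∀ s : ℂ, 1 < s.re → g s = (s - 1) ^ (t + 1) * ∑' x : ι, (H x : ℂ) ^ (-s))
    (φ : 𝓢(ℝ, ℂ)) (hφ : HasCompactSupport φ) :
    ∃ R : ℝ → ℂ, (∀ v : ℝ, Tendsto (fun δ : ℝ =>
        ∑' x, ((H x ^ (-(1 + δ)) : ℝ) : ℂ) * 𝓕 φ (Real.log (H x) - v)) (𝓝[>] 0) (𝓝 (R v))) ∧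
      Tendsto (fun v : ℝ => R v / (v : ℂ) ^ t) atTop
        (𝓝 (g 1 / t.factorial * ∫ w, 𝓕 φ w)) := by
  have hG : DifferentiableOn ℂ (fun z => g (1 + z)) {z | -ε < z.re} := by
    refine hg.comp (by fun_prop) fun z hz => ?_
    have : -ε < z.re := hz
    show 1 - ε < (1 + z).re
    rw [Complex.add_re, Complex.one_re]
    linarith
  obtain ⟨R, hR, -, hR1⟩ := exists_tendsto_integral_phase_div_pow φ hφ hε (t + 1) _ hG
  refine ⟨R, fun v => (hR v).congr' ?_, by simpa using hR1 t rfl⟩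
  filter_upwards [self_mem_nhdsWithin] with δ hδ
  have hδ : 0 < δ := hδ
  rw [(hasSum_rpow_mul_fourier hH hconv φ v hδ).tsum_eq]
  refine integral_congr_ae (ae_of_all _ fun y => ?_)
  have hz : (δ + 2 * π * y * Complex.I : ℂ) ≠ 0 := fun h => by
    have := congrArg Complex.re h
    simp at this
    linarith
  simp only
  rw [hgζ (1 + (δ + 2 * π * y * Complex.I)) (by simpa using hδ), add_sub_cancel_left,
    mul_div_cancel_left₀ _ (pow_ne_zero _ hz)]

lemma summable_inv_mul [Countable ι] (hH : ∀ x, 1 ≤ H x)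
    (hconv : ∀ s : ℂ, 1 < s.re → Summable fun x : ι => ‖(H x : ℂ) ^ (-s)‖)
    (hε : 0 < ε) (hg : DifferentiableOn ℂ g {s : ℂ | 1 - ε < s.re})
    (hgζ : ∀ s : ℂ, 1 < s.re → g s = (s - 1) ^ (t + 1) * ∑' x : ι, (H x : ℂ) ^ (-s))
    (φ : 𝓢(ℝ, ℂ)) (hφ : HasCompactSupport φ) {ρ : ℝ → ℝ} (hρ : ∀ w, 0 ≤ ρ w)
    (hφρ : ∀ w, 𝓕 φ w = ρ w) (v : ℝ) :
    Summable fun x => (H x)⁻¹ * ρ (Real.log (H x) - v) := by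
  obtain ⟨R, hR, -⟩ := exists_tendsto_smoothed_series hH hconv hε hg hgζ φ hφ
  have h0 (x : ι) : 0 < H x := one_pos.trans_le (hH x)
  refine summable_of_sum_le (c := (R v).re)
    (fun x => mul_nonneg (inv_nonneg.2 (h0 x).le) (hρ _)) fun F => ?_
  have h1 := (Complex.continuous_re.tendsto _).comp (hR v)
  have h2 : Tendsto (fun δ : ℝ => ∑ x ∈ F, H x ^ (-(1 + δ)) * ρ (Real.log (H x) - v)) (𝓝[>] 0)
      (𝓝 (∑ x ∈ F, (H x)⁻¹ * ρ (Real.log (H x) - v))) :=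
    tendsto_finsetSum _ fun x _ => (tendsto_rpow_neg hH x).mul_const _
  refine le_of_tendsto_of_tendsto h2 h1 ?_
  filter_upwards [self_mem_nhdsWithin] with δ hδ
  have h3 := hasSum_rpow_mul_fourier hH hconv φ v hδ
  simp only [Function.comp]
  have h4 := Complex.hasSum_re h3.summable.hasSum
  refine (Eq.le ?_).trans (sum_le_hasSum F (fun x _ => ?_) h4)
  · refine Finset.sum_congr rfl fun x _ => ?_
    rw [hφρ, ← Complex.ofReal_mul, Complex.ofReal_re]
  · rw [hφρ, ← Complex.ofReal_mul, Complex.ofReal_re]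
    exact mul_nonneg (Real.rpow_nonneg (h0 x).le _) (hρ _)

lemma tendsto_tsum_inv_mul_fourier [Countable ι] (hH : ∀ x, 1 ≤ H x)
    (hconv : ∀ s : ℂ, 1 < s.re → Summable fun x : ι => ‖(H x : ℂ) ^ (-s)‖)
    (hε : 0 < ε) (hg : DifferentiableOn ℂ g {s : ℂ | 1 - ε < s.re})
    (hgζ : ∀ s : ℂ, 1 < s.re → g s = (s - 1) ^ (t + 1) * ∑' x : ι, (H x : ℂ) ^ (-s))
    (φ : 𝓢(ℝ, ℂ)) (hφ : HasCompactSupport φ) {ρ : ℝ → ℝ}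
    (hsum : ∀ v, Summable fun x => (H x)⁻¹ * ρ (Real.log (H x) - v))
    (hφρ : ∀ w, ‖𝓕 φ w‖ ≤ ρ w) :
    Tendsto (fun v : ℝ => (∑' x, (((H x)⁻¹ : ℝ) : ℂ) * 𝓕 φ (Real.log (H x) - v)) / (v : ℂ) ^ t)
      atTop (𝓝 (g 1 / t.factorial * ∫ w, 𝓕 φ w)) := by
  obtain ⟨R, hR, hR1⟩ := exists_tendsto_smoothed_series hH hconv hε hg hgζ φ hφ
  refine hR1.congr fun v => ?_
  congr 1
  refine tendsto_nhds_unique (hR v) ?_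
  refine tendsto_tsum_of_dominated_convergence (hsum v) (fun x => ?_) ?_
  · exact ((Complex.continuous_ofReal.tendsto _).comp (tendsto_rpow_neg hH x)).mul_const _
  · filter_upwards [self_mem_nhdsWithin] with δ hδ x
    have hδ : 0 < δ := hδ
    have h0 : 0 < H x := one_pos.trans_le (hH x)
    rw [norm_mul, Complex.norm_real, Real.norm_of_nonneg (Real.rpow_nonneg h0.le _)]
    refine mul_le_mul ?_ (hφρ _) (norm_nonneg _) (inv_nonneg.2 h0.le)
    rw [← Real.rpow_neg_one]
    exact Real.rpow_le_rpow_of_exponent_le (hH x) (by linarith)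

end Series

lemma exists_nonneg_fourier_kernel : ∃ ρ : ℝ → ℝ, Continuous ρ ∧ (∀ w, 0 ≤ ρ w) ∧ 0 < ρ 0 ∧
    Integrable ρ ∧ ∀ τ : ℝ, ∃ φ : 𝓢(ℝ, ℂ), HasCompactSupport φ ∧
      ∀ w : ℝ, 𝓕 φ w = Complex.exp (τ * w * Complex.I) * ρ w := by
  let f : ContDiffBump (0 : ℝ) := ⟨1, 2, one_pos, one_lt_two⟩
  let F : ℝ → ℂ := fun x => f x
  have hFc : HasCompactSupport F := f.hasCompactSupport.comp_left Complex.ofReal_zero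
  have hFs : ContDiff ℝ ∞ F := Complex.ofRealCLM.contDiff.comp f.contDiff
  have hFi : Integrable F := hFs.continuous.integrable_of_hasCompactSupport hFc
  let φ : 𝓢(ℝ, ℂ) := HasCompactSupport.toSchwartzMap
    (HasCompactSupport.convolution (ContinuousLinearMap.mul ℂ ℂ) (μ := volume) hFc hFc)
    (show ContDiff ℝ ∞ (MeasureTheory.convolution F F (ContinuousLinearMap.mul ℝ ℂ) volume) from
      hFc.contDiff_convolution_left _ (n := ⊤) hFs hFi.locallyIntegrable)
  have hφc : HasCompactSupport φ :=
    HasCompactSupport.convolution (ContinuousLinearMap.mul ℂ ℂ) (μ := volume) hFc hFc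
  have hφF (w : ℝ) : 𝓕 φ w = 𝓕 F w * 𝓕 F w := by
    rw [SchwartzMap.fourier_coe]
    exact Real.fourier_mul_convolution_eq hFi hFi w
  have hreal (w : ℝ) : ((𝓕 F w).re : ℂ) = 𝓕 F w := by
    rw [← Complex.conj_eq_iff_re, Real.fourier_real_eq_integral_exp_smul, ← integral_conj,
      ← integral_neg_eq_self]
    refine integral_congr_ae (ae_of_all _ fun y => ?_)
    simp only [F, smul_eq_mul, map_mul, ← Complex.exp_conj, Complex.conj_ofReal, Complex.conj_I,
      f.neg]
    congr 2
    push_cast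
    ring
  have hρ (w : ℝ) : 𝓕 φ w = (((𝓕 F w).re ^ 2 : ℝ) : ℂ) := by
    rw [hφF, Complex.ofReal_pow, hreal, sq]
  have hρ' (w : ℝ) : (𝓕 F w).re ^ 2 = (𝓕 φ w).re := by rw [hρ, Complex.ofReal_re]
  refine ⟨fun w => (𝓕 F w).re ^ 2, ?_, fun w => sq_nonneg _, ?_, ?_, fun τ => ?_⟩
  · simp_rw [hρ']
    exact Complex.continuous_re.comp (𝓕 φ).continuous
  · have h0 : 𝓕 F 0 = ((∫ y, f y : ℝ) : ℂ) := by
      rw [Real.fourier_real_eq_integral_exp_smul, ← integral_complex_ofReal]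
      simp [F]
    have hp : 0 < ∫ y, f y := f.integral_pos
    simp only [h0, Complex.ofReal_re]
    positivity
  · simp_rw [hρ']
    exact ((𝓕 φ).integrable (μ := volume)).re
  · refine ⟨SchwartzMap.compSubConstCLM ℂ (-(τ / (2 * π))) φ, ?_, fun w => ?_⟩
    · exact hφc.comp_homeomorph (Homeomorph.subRight (-(τ / (2 * π))))
    · rw [SchwartzMap.fourier_coe, ← hρ, SchwartzMap.fourier_coe,
        Real.fourier_real_eq_integral_exp_smul, Real.fourier_real_eq_integral_exp_smul,
        ← integral_const_mul, ← integral_sub_right_eq_self _ (τ / (2 * π))]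
      refine integral_congr_ae (ae_of_all _ fun y => ?_)
      simp only [SchwartzMap.compSubConstCLM_apply, smul_eq_mul, sub_neg_eq_add, sub_add_cancel]
      rw [← mul_assoc, ← Complex.exp_add]
      congr 2
      have : (π : ℂ) ≠ 0 := by exact_mod_cast Real.pi_ne_zero
      push_cast
      field_simp
      ring

section WeakConvergence

variable {ι : Type*} {a ℓ : ι → ℝ} {ρ : ℝ → ℝ} {t : ℕ}

lemma exists_pos_ofReal_eq (ha : ∀ x, 0 ≤ a x) (hρ : ∀ w, 0 ≤ ρ w) (hρI : 0 < ∫ w, ρ w)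
    {C : ℂ} (hC : C ≠ 0)
    (h : Tendsto (fun v : ℝ => (∑' x, (a x : ℂ) * ρ (ℓ x - v)) / (v : ℂ) ^ t) atTop
      (𝓝 (C * ∫ w, (ρ w : ℂ)))) : ∃ c : ℝ, 0 < c ∧ C = c := by
  rw [integral_complex_ofReal] at h
  have hv (v : ℝ) : (∑' x, (a x : ℂ) * ρ (ℓ x - v)) / (v : ℂ) ^ t =
      (((∑' x, a x * ρ (ℓ x - v)) / v ^ t : ℝ) : ℂ) := by
    push_cast
    rfl
  simp_rw [hv] at h
  have him := (Complex.continuous_im.tendsto _).comp h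
  have hre := (Complex.continuous_re.tendsto _).comp h
  simp only [Function.comp_def, Complex.ofReal_im, Complex.ofReal_re, Complex.im_mul_ofReal,
    Complex.re_mul_ofReal] at him hre
  have him0 := tendsto_nhds_unique him tendsto_const_nhds
  have hre0 : 0 ≤ C.re * ∫ w, ρ w := by
    refine ge_of_tendsto hre ?_
    filter_upwards [eventually_ge_atTop 0] with v hv0
    exact div_nonneg (tsum_nonneg fun x => mul_nonneg (ha x) (hρ _)) (pow_nonneg hv0 _)
  have h1 : C.im = 0 := (mul_eq_zero.1 him0).resolve_right hρI.ne'
  have h2 : 0 ≤ C.re := nonneg_of_mul_nonneg_left hre0 hρI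
  have h3 : C = C.re := Complex.ext rfl (by simp [h1])
  refine ⟨C.re, lt_of_le_of_ne h2 fun h4 => hC ?_, h3⟩
  rw [h3, ← h4, Complex.ofReal_zero]

/-- Convergence against all modulations of a nonnegative kernel implies convergence of the
weighted counts in bounded intervals. -/
lemma tendsto_tsum_indicator [Countable ι] (ha : ∀ x, 0 ≤ a x) (hρc : Continuous ρ)
    (hρ : ∀ w, 0 ≤ ρ w)
    (hρi : Integrable ρ) (hρI : 0 < ∫ w, ρ w)
    (hsum : ∀ v, Summable fun x => a x * ρ (ℓ x - v)) {c : ℝ} (hc : 0 < c)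
    (h : ∀ τ : ℝ, Tendsto (fun v : ℝ => (∑' x, (a x : ℂ) *
        (Complex.exp (τ * ((ℓ x - v : ℝ) : ℂ) * Complex.I) * ρ (ℓ x - v))) / (v : ℂ) ^ t) atTop
      (𝓝 (c * ∫ w : ℝ, Complex.exp (τ * (w : ℂ) * Complex.I) * (ρ w : ℂ)))) (p q : ℝ) :
    Tendsto (fun v : ℝ => (∑' x, a x * (Ioc p q).indicator ρ (ℓ x - v)) / v ^ t) atTop
      (𝓝 (c * ∫ w in Ioc p q, ρ w)) := by
  set I₀ := ∫ w, ρ w with hI₀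
  set M : ℝ → ℝ := fun v => ∑' x, a x * ρ (ℓ x - v) with hM
  have hM0 (v : ℝ) (x : ι) : 0 ≤ a x * ρ (ℓ x - v) := mul_nonneg (ha x) (hρ _)
  have hMlim : Tendsto (fun v => M v / v ^ t) atTop (𝓝 (c * I₀)) := by
    have h0 := (Complex.continuous_re.tendsto _).comp (h 0)
    simp only [Complex.ofReal_zero, zero_mul, Complex.exp_zero, one_mul,
      integral_complex_ofReal, Complex.re_mul_ofReal, Complex.ofReal_re] at h0
    refine h0.congr fun v => ?_
    rw [Function.comp, ← Complex.ofReal_re (M v / v ^ t)]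
    congr 1
    push_cast [hM]
    rfl
  have hMpos : ∀ᶠ v in atTop, 0 < M v := by
    filter_upwards [hMlim.eventually (lt_mem_nhds (mul_pos hc hρI)), eventually_gt_atTop 0]
      with v hv hv0
    exact (div_pos_iff_of_pos_right (pow_pos hv0 t)).1 hv
  let wt : ℝ → ι → ENNReal := fun v x => ENNReal.ofReal (a x * ρ (ℓ x - v) / M v)
  have hwt (v : ℝ) (hv : 0 < M v) (x : ι) : (wt v x).toReal = a x * ρ (ℓ x - v) / M v :=
    ENNReal.toReal_ofReal (div_nonneg (hM0 v x) hv.le)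
  have hwt' (v : ℝ) (x : ι) : wt v x ≠ ⊤ := ENNReal.ofReal_ne_top
  have hP (v : ℝ) : ∃ P : ProbabilityMeasure ℝ, 0 < M v →
      (P : Measure ℝ) = Measure.sum fun x => wt v x • Measure.dirac (ℓ x - v) := by
    by_cases hv : 0 < M v
    · refine ⟨⟨Measure.sum fun x => wt v x • Measure.dirac (ℓ x - v), ⟨?_⟩⟩, fun _ => rfl⟩
      rw [Measure.sum_apply _ MeasurableSet.univ]
      simp only [Measure.smul_apply, measure_univ, smul_eq_mul, mul_one]
      rw [← ENNReal.ofReal_tsum_of_nonneg (fun x => div_nonneg (hM0 v x) hv.le)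
        ((hsum v).div_const _), tsum_div_const, div_self hv.ne', ENNReal.ofReal_one]
    · exact ⟨⟨Measure.dirac 0, inferInstance⟩, fun h => absurd h hv⟩
  choose P hP using hP
  have hPint (v : ℝ) (hv : 0 < M v) (f : ℝ → ℂ) :
      ∫ w, f w ∂(P v : Measure ℝ) = (∑' x, (a x : ℂ) * (f (ℓ x - v) * ρ (ℓ x - v))) / M v := by
    rw [hP v hv, integral_sum_dirac (hwt' v), ← tsum_div_const]
    refine tsum_congr fun x => ?_
    rw [hwt v hv, Complex.real_smul]
    push_cast
    ring
  have hdens : Measurable fun w => ENNReal.ofReal (ρ w / I₀) := by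
    have := hρc.measurable
    fun_prop
  let P₀ : ProbabilityMeasure ℝ :=
    ⟨volume.withDensity fun w => ENNReal.ofReal (ρ w / I₀), ⟨by
      rw [withDensity_apply _ MeasurableSet.univ, Measure.restrict_univ,
        ← ofReal_integral_eq_lintegral_ofReal (hρi.div_const _)
          (ae_of_all _ fun w => div_nonneg (hρ w) hρI.le), integral_div, div_self hρI.ne',
        ENNReal.ofReal_one]⟩⟩
  have hP₀int (f : ℝ → ℂ) : ∫ w, f w ∂(P₀ : Measure ℝ) = (∫ w, f w * ρ w) / I₀ := by
    show ∫ w, f w ∂(volume.withDensity fun w => ENNReal.ofReal (ρ w / I₀)) = _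
    rw [integral_withDensity_eq_integral_toReal_smul hdens
      (ae_of_all _ fun w => ENNReal.ofReal_lt_top), ← integral_div]
    refine integral_congr_ae (ae_of_all _ fun w => ?_)
    simp only
    rw [ENNReal.toReal_ofReal (div_nonneg (hρ w) hρI.le), Complex.real_smul]
    push_cast
    ring
  have hcI : ((c * I₀ : ℝ) : ℂ) ≠ 0 := by exact_mod_cast (mul_pos hc hρI).ne'
  have hchar (τ : ℝ) : Tendsto (fun v => charFun (P v : Measure ℝ) τ) atTop
      (𝓝 (charFun (P₀ : Measure ℝ) τ)) := by
    have h1 := (h τ).div ((Complex.continuous_ofReal.tendsto _).comp hMlim) hcI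
    have h2 : (c * ∫ w : ℝ, Complex.exp (τ * (w : ℂ) * Complex.I) * (ρ w : ℂ)) / ((c * I₀ : ℝ) : ℂ) =
        charFun (P₀ : Measure ℝ) τ := by
      rw [charFun_apply_real, hP₀int]
      have : (c : ℂ) ≠ 0 := by exact_mod_cast hc.ne'
      push_cast
      rw [mul_div_mul_left _ _ this]
    rw [h2] at h1
    refine h1.congr' ?_
    filter_upwards [hMpos, eventually_gt_atTop 0] with v hv hv0
    rw [charFun_apply_real, hPint v hv]
    have : (v : ℂ) ^ t ≠ 0 := pow_ne_zero _ (by exact_mod_cast hv0.ne')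
    simp only [Pi.div_apply, Function.comp]
    push_cast
    rw [div_div_div_cancel_right₀ this]
  have hweak : Tendsto P atTop (𝓝 P₀) := tendsto_of_seq_tendsto fun u hu =>
    ProbabilityMeasure.tendsto_of_tendsto_charFun fun τ => (hchar τ).comp hu
  have hfront : (P₀ : Measure ℝ) (frontier (Ioc p q)) = 0 := by
    refine withDensity_absolutelyContinuous _ _ ?_
    exact (convex_Ioc p q).addHaar_frontier volume
  have hE := (ENNReal.tendsto_toReal (measure_ne_top _ _)).comp
    (ProbabilityMeasure.tendsto_measure_of_null_frontier_of_tendsto' hweak hfront)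
  have hlim : c * ∫ w in Ioc p q, ρ w = ((P₀ : Measure ℝ) (Ioc p q)).toReal * (c * I₀) := by
    show _ = ((volume.withDensity fun w => ENNReal.ofReal (ρ w / I₀)) (Ioc p q)).toReal * _
    rw [withDensity_apply _ measurableSet_Ioc, ← integral_toReal
      hdens.aemeasurable (ae_of_all _ fun w => ENNReal.ofReal_lt_top)]
    simp_rw [fun w => ENNReal.toReal_ofReal (div_nonneg (hρ w) hρI.le)]
    rw [integral_div]
    field_simp
  rw [hlim]
  refine (hE.mul hMlim).congr' ?_
  filter_upwards [hMpos, eventually_gt_atTop 0] with v hv hv0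
  simp only [Function.comp]
  rw [← measureReal_def, ← integral_indicator_one measurableSet_Ioc, hP v hv,
    integral_sum_dirac (hwt' v), ← mul_div_assoc, ← tsum_mul_right]
  congr 1
  refine tsum_congr fun x => ?_
  rw [hwt v hv, smul_eq_mul]
  by_cases hx : ℓ x - v ∈ Ioc p q
  · simp only [indicator_of_mem hx, Pi.one_apply]
    field_simp
  · simp only [indicator_of_notMem hx]
    ring

end WeakConvergence

section Counting

variable {N : ℝ → ℝ} {t : ℕ} {c : ℝ}

lemma mul_exp_neg_le_one_sub_exp_neg (δ : ℝ) : δ * Real.exp (-δ) ≤ 1 - Real.exp (-δ) := by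
  have h := mul_le_mul_of_nonneg_right (Real.add_one_le_exp δ) (Real.exp_pos (-δ)).le
  rw [← Real.exp_add, add_neg_cancel, Real.exp_zero] at h
  linarith

lemma le_add_of_increment_le (hN : Monotone N) {δ K v₀ : ℝ} (hδ : 0 < δ) (hK : 0 ≤ K)
    (hv₀ : 0 ≤ v₀) (h : ∀ v ≥ v₀, N v - N (v - δ) ≤ K * (Real.exp v * v ^ t)) :
    ∀ v ≥ v₀, N v ≤ N v₀ + K / (1 - Real.exp (-δ)) * (Real.exp v * v ^ t) := by
  have hq : 0 < 1 - Real.exp (-δ) := by simpa using hδ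
  set K' := K / (1 - Real.exp (-δ)) with hK'
  have hK'0 : 0 ≤ K' := div_nonneg hK hq.le
  have hKK : K + K' * Real.exp (-δ) = K' := by
    rw [hK']; field_simp; ring
  have key (n : ℕ) : ∀ v ≥ v₀, v ≤ v₀ + n * δ → N v ≤ N v₀ + K' * (Real.exp v * v ^ t) := by
    induction n with
    | zero =>
      intro v hv hv'
      obtain rfl : v = v₀ := le_antisymm (by simpa using hv') hv
      have : 0 ≤ v ^ t := pow_nonneg hv₀ t
      have : 0 ≤ K' * (Real.exp v * v ^ t) := by positivity
      linarith
    | succ n ih =>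
      intro v hv hv'
      have hv0 : 0 ≤ v := hv₀.trans hv
      have hpow : 0 ≤ v ^ t := pow_nonneg hv0 t
      have hstep := h v hv
      have hbound : N (v - δ) ≤ N v₀ + K' * Real.exp (-δ) * (Real.exp v * v ^ t) := by
        by_cases hc : v₀ ≤ v - δ
        · refine (ih (v - δ) hc ?_).trans ?_
          · push_cast at hv'; linarith
          · have h1 : (v - δ) ^ t ≤ v ^ t :=
              pow_le_pow_left₀ (hv₀.trans hc) (by linarith) t
            rw [mul_assoc K', ← mul_assoc (Real.exp (-δ)), ← Real.exp_add, neg_add_eq_sub]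
            gcongr
        · have h1 := hN (not_le.1 hc).le
          have : 0 ≤ K' * Real.exp (-δ) * (Real.exp v * v ^ t) := by positivity
          linarith
      calc N v ≤ N v₀ + K' * Real.exp (-δ) * (Real.exp v * v ^ t)
            + K * (Real.exp v * v ^ t) := by linarith
        _ = N v₀ + (K + K' * Real.exp (-δ)) * (Real.exp v * v ^ t) := by ring
        _ = _ := by rw [hKK]
  intro v hv
  obtain ⟨n, hn⟩ := exists_nat_ge ((v - v₀) / δ)
  refine key n v hv ?_
  rw [div_le_iff₀ hδ] at hn
  linarith

lemma eventually_sum_le_of_le_increment (hN0 : ∀ v, 0 ≤ N v) {δ K : ℝ}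
    (h : ∀ᶠ v in atTop, K * (Real.exp v * v ^ t) ≤ N v - N (v - δ)) (m : ℕ) :
    ∀ᶠ v in atTop, K * ∑ j ∈ Finset.range m,
      Real.exp (v - j * δ) * (v - j * δ) ^ t ≤ N v := by
  induction m with
  | zero => exact Eventually.of_forall fun v => by simpa using hN0 v
  | succ m ih =>
    filter_upwards [h, (tendsto_atTop_add_const_right atTop (-δ) tendsto_id).eventually ih]
      with v h1 h2
    rw [Finset.sum_range_succ', mul_add]
    have h3 : ∑ j ∈ Finset.range m, Real.exp (id v + -δ - j * δ) * (id v + -δ - j * δ) ^ t =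
        ∑ j ∈ Finset.range m,
          Real.exp (v - (j + 1 : ℕ) * δ) * (v - (j + 1 : ℕ) * δ) ^ t := by
      refine Finset.sum_congr rfl fun j _ => ?_
      have : id v + -δ - j * δ = v - (j + 1 : ℕ) * δ := by
        push_cast [id]; ring
      rw [this]
    rw [h3, id, ← sub_eq_add_neg] at h2
    simp only [Nat.cast_zero, zero_mul, sub_zero]
    linarith

lemma tendsto_sum_exp_mul_pow_div (δ : ℝ) (m : ℕ) :
    Tendsto (fun v : ℝ => (∑ j ∈ Finset.range m, Real.exp (v - j * δ) * (v - j * δ) ^ t) /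
      (Real.exp v * v ^ t)) atTop (𝓝 (∑ j ∈ Finset.range m, Real.exp (-δ) ^ j)) := by
  have h : Tendsto (fun v : ℝ => ∑ j ∈ Finset.range m,
      Real.exp (-δ) ^ j * (1 - j * δ / v) ^ t) atTop
      (𝓝 (∑ j ∈ Finset.range m, Real.exp (-δ) ^ j * (1 - 0) ^ t)) :=
    tendsto_finsetSum _ fun j _ => (((tendsto_const_nhds.div_atTop tendsto_id).const_sub 1).pow
      t).const_mul _
  simp only [sub_zero, one_pow, mul_one] at h
  refine h.congr' ?_
  filter_upwards [eventually_gt_atTop 0] with v hv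
  rw [Finset.sum_div]
  refine Finset.sum_congr rfl fun j _ => ?_
  rw [← Real.exp_nat_mul, show v - j * δ = v + j * -δ by ring, Real.exp_add,
    show 1 - j * δ / v = (v + j * -δ) / v by field_simp; ring, div_pow]
  have := (Real.exp_pos v).ne'
  field_simp

/-- Asymptotics of the increments over arbitrarily short intervals determine the asymptotics
of a monotone function of exponential growth. -/
lemma tendsto_div_of_increments (hN : Monotone N) (hN0 : ∀ v, 0 ≤ N v) (hc : 0 < c)
    (h : ∀ κ > 1, ∃ δ > 0, δ ≤ Real.log κ ∧ ∀ᶠ v in atTop,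
      c * δ / κ ^ 4 * (Real.exp v * v ^ t) ≤ N v - N (v - δ) ∧
      N v - N (v - δ) ≤ c * δ * κ ^ 4 * (Real.exp v * v ^ t)) :
    Tendsto (fun v => N v / (Real.exp v * v ^ t)) atTop (𝓝 c) := by
  have hupper (κ : ℝ) (hκ : 1 < κ) : ∀ᶠ v in atTop, N v / (Real.exp v * v ^ t) < c * κ ^ 6 := by
    obtain ⟨δ, hδ, hδκ, hev⟩ := h κ hκ
    obtain ⟨v₁, hv₁⟩ := eventually_atTop.1 hev
    have hq : 0 < 1 - Real.exp (-δ) := by simpa using hδ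
    have hκ0 : 0 < κ := by linarith
    have hδle : δ / (1 - Real.exp (-δ)) ≤ κ := by
      rw [div_le_iff₀ hq]
      have h1 := mul_exp_neg_le_one_sub_exp_neg δ
      have h2 : κ⁻¹ ≤ Real.exp (-δ) := by
        rw [Real.exp_neg]
        exact inv_anti₀ (Real.exp_pos _) ((Real.le_log_iff_exp_le hκ0).1 hδκ)
      calc δ = κ * (δ * κ⁻¹) := by field_simp
        _ ≤ κ * (δ * Real.exp (-δ)) := by gcongr
        _ ≤ _ := by gcongr
    have hN' := le_add_of_increment_le hN (K := c * δ * κ ^ 4) (v₀ := max v₁ 1) hδ (by positivity)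
      (by positivity) fun v hv => (hv₁ v ((le_max_left _ _).trans hv)).2
    have hsmall : Tendsto (fun v : ℝ => N (max v₁ 1) / Real.exp v) atTop (𝓝 0) :=
      tendsto_const_nhds.div_atTop Real.tendsto_exp_atTop
    have hpos : 0 < c * κ ^ 6 - c * κ ^ 5 := by
      rw [← mul_sub]
      exact mul_pos hc (sub_pos.2 (pow_lt_pow_right₀ hκ (by norm_num)))
    filter_upwards [hsmall.eventually (gt_mem_nhds hpos), eventually_ge_atTop (max v₁ 1)]
      with v h1 h2
    have hv1 : 1 ≤ v := (le_max_right _ _).trans h2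
    have hvt : 1 ≤ v ^ t := one_le_pow₀ hv1
    have hE : 0 < Real.exp v * v ^ t := by positivity
    rw [div_lt_iff₀ (Real.exp_pos v)] at h1
    rw [div_lt_iff₀ hE]
    calc N v ≤ N (max v₁ 1) + c * κ ^ 4 * (δ / (1 - Real.exp (-δ))) * (Real.exp v * v ^ t) := by
          refine (hN' v h2).trans_eq ?_
          ring
      _ < (c * κ ^ 6 - c * κ ^ 5) * Real.exp v + c * κ ^ 4 * κ * (Real.exp v * v ^ t) := by
          refine add_lt_add_of_lt_of_le h1 ?_
          gcongr
      _ ≤ (c * κ ^ 6 - c * κ ^ 5) * (Real.exp v * v ^ t) + c * κ ^ 4 * κ * (Real.exp v * v ^ t) := by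
          gcongr
          exact le_mul_of_one_le_right (Real.exp_pos v).le hvt
      _ = c * κ ^ 6 * (Real.exp v * v ^ t) := by ring
  have hlower (κ : ℝ) (hκ : 1 < κ) : ∀ᶠ v in atTop, c / κ ^ 6 < N v / (Real.exp v * v ^ t) := by
    obtain ⟨δ, hδ, -, hev⟩ := h κ hκ
    have hq : 0 < 1 - Real.exp (-δ) := by simpa using hδ
    have hκ0 : 0 < κ := by linarith
    have hκ4 : c / κ ^ 6 < c / κ ^ 4 * (1 - 0) := by
      rw [sub_zero, mul_one]
      exact div_lt_div_of_pos_left hc (by positivity) (pow_lt_pow_right₀ hκ (by norm_num))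
    have hqm := ((tendsto_pow_atTop_nhds_zero_of_lt_one (Real.exp_pos (-δ)).le
      (by linarith : Real.exp (-δ) < 1)).const_sub 1).const_mul (c / κ ^ 4)
    obtain ⟨m, hm⟩ := (hqm.eventually (lt_mem_nhds hκ4)).exists
    have hlim := (tendsto_sum_exp_mul_pow_div (t := t) δ m).const_mul (c * δ / κ ^ 4)
    have hlt : c / κ ^ 6 < c * δ / κ ^ 4 * ∑ j ∈ Finset.range m, Real.exp (-δ) ^ j := by
      refine hm.trans_le ?_
      rw [← mul_neg_geom_sum, mul_div_right_comm, mul_assoc]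
      have hs : 0 ≤ ∑ j ∈ Finset.range m, Real.exp (-δ) ^ j :=
        Finset.sum_nonneg fun j _ => by positivity
      have hle : 1 - Real.exp (-δ) ≤ δ := by linarith [Real.add_one_le_exp (-δ)]
      gcongr
    filter_upwards [hlim.eventually (lt_mem_nhds hlt), eventually_gt_atTop 0,
      eventually_sum_le_of_le_increment hN0 (hev.mono fun v hv => hv.1) m] with v h1 h2 h3
    refine h1.trans_le ?_
    rw [← mul_div_assoc]
    gcongr
  have hcont : Tendsto (fun κ : ℝ => κ ^ 6) (𝓝[>] 1) (𝓝 1) := by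
    have : Continuous fun κ : ℝ => κ ^ 6 := by fun_prop
    simpa using (this.tendsto 1).mono_left (nhdsWithin_le_nhds (s := Ioi 1))
  refine tendsto_order.2 ⟨fun b hb => ?_, fun b hb => ?_⟩
  · have h1 := (tendsto_const_nhds (x := c)).div hcont one_ne_zero
    rw [div_one] at h1
    obtain ⟨κ, hκ, hκ1⟩ := ((h1.eventually (lt_mem_nhds hb)).and self_mem_nhdsWithin).exists
    exact (hlower κ hκ1).mono fun v hv => hκ.trans hv
  · have h1 := hcont.const_mul c
    rw [mul_one] at h1
    obtain ⟨κ, hκ, hκ1⟩ := ((h1.eventually (gt_mem_nhds hb)).and self_mem_nhdsWithin).exists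
    exact (hupper κ hκ1).mono fun v hv => hv.trans hκ

variable {ι : Type*} {H : ι → ℝ}

lemma natCard_eq_card_toFinset (hfin : ∀ B : ℝ, {x : ι | H x ≤ B}.Finite) (B : ℝ) :
    Nat.card {x : ι // H x ≤ B} = (hfin B).toFinset.card :=
  Nat.card_eq_card_finite_toFinset (hfin B)

lemma monotone_natCard (hfin : ∀ B : ℝ, {x : ι | H x ≤ B}.Finite) :
    Monotone fun v : ℝ => (Nat.card {x : ι // H x ≤ Real.exp v} : ℝ) := by
  intro v w hvw
  simp only [natCard_eq_card_toFinset hfin, Nat.cast_le]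
  refine Finset.card_le_card (Finite.toFinset_subset_toFinset.2 fun x hx => ?_)
  exact le_trans (show H x ≤ Real.exp v from hx) (Real.exp_le_exp.2 hvw)

/-- Comparison of a smoothed count over a short interval with the plain count. -/
lemma card_sub_card_bounds (hH : ∀ x, 1 ≤ H x) (hfin : ∀ B : ℝ, {x : ι | H x ≤ B}.Finite)
    {ρ : ℝ → ℝ} {δ r R : ℝ} (hδ : 0 ≤ δ) (hr : 0 ≤ r)
    (hρ : ∀ w ∈ Ioc (-δ) 0, r ≤ ρ w ∧ ρ w ≤ R) (v : ℝ) :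
    r * Real.exp (-v) * ((Nat.card {x : ι // H x ≤ Real.exp v} : ℝ) -
        Nat.card {x : ι // H x ≤ Real.exp (v - δ)}) ≤
      ∑' x, (H x)⁻¹ * (Ioc (-δ) 0).indicator ρ (Real.log (H x) - v) ∧
    ∑' x, (H x)⁻¹ * (Ioc (-δ) 0).indicator ρ (Real.log (H x) - v) ≤
      R * Real.exp (δ - v) * ((Nat.card {x : ι // H x ≤ Real.exp v} : ℝ) -
        Nat.card {x : ι // H x ≤ Real.exp (v - δ)}) := by
  classical
  set S := (hfin (Real.exp v)).toFinset \ (hfin (Real.exp (v - δ))).toFinset with hS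
  have hsub : (hfin (Real.exp (v - δ))).toFinset ⊆ (hfin (Real.exp v)).toFinset :=
    Finite.toFinset_subset_toFinset.2 fun x hx =>
      le_trans (show H x ≤ Real.exp (v - δ) from hx) (Real.exp_le_exp.2 (by linarith))
  have hcard : (Nat.card {x : ι // H x ≤ Real.exp v} : ℝ) -
      Nat.card {x : ι // H x ≤ Real.exp (v - δ)} = S.card := by
    rw [natCard_eq_card_toFinset hfin, natCard_eq_card_toFinset hfin,
      hS, Finset.card_sdiff_of_subset hsub, Nat.cast_sub (Finset.card_le_card hsub)]
  have h0 (x : ι) : 0 < H x := one_pos.trans_le (hH x)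
  have hmem (x : ι) : x ∈ S ↔ Real.log (H x) - v ∈ Ioc (-δ) 0 := by
    have h1 : H x ≤ Real.exp v ↔ Real.log (H x) ≤ v := (Real.log_le_iff_le_exp (h0 x)).symm
    have h2 : H x ≤ Real.exp (v - δ) ↔ Real.log (H x) ≤ v - δ :=
      (Real.log_le_iff_le_exp (h0 x)).symm
    rw [hS, Finset.mem_sdiff, Finite.mem_toFinset, Finite.mem_toFinset]
    change H x ≤ Real.exp v ∧ ¬ H x ≤ Real.exp (v - δ) ↔ _
    rw [h1, h2, mem_Ioc, not_le]
    constructor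
    · rintro ⟨h3, h4⟩; constructor <;> linarith
    · rintro ⟨h3, h4⟩; constructor <;> linarith
  have hsum : ∑' x, (H x)⁻¹ * (Ioc (-δ) 0).indicator ρ (Real.log (H x) - v) =
      ∑ x ∈ S, (H x)⁻¹ * ρ (Real.log (H x) - v) := by
    rw [tsum_eq_sum (s := S) fun x hx => by
      rw [indicator_of_notMem (fun h => hx ((hmem x).2 h)), mul_zero]]
    exact Finset.sum_congr rfl fun x hx => by rw [indicator_of_mem ((hmem x).1 hx)]
  have hinv (x : ι) : (H x)⁻¹ = Real.exp (-Real.log (H x)) := by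
    rw [Real.exp_neg, Real.exp_log (h0 x)]
  rw [hcard, hsum, mul_comm _ (S.card : ℝ), mul_comm _ (S.card : ℝ), ← nsmul_eq_mul,
    ← nsmul_eq_mul]
  constructor
  · refine Finset.card_nsmul_le_sum _ _ _ fun x hx => ?_
    have hx' := (hmem x).1 hx
    rw [hinv, mul_comm]
    refine mul_le_mul (Real.exp_le_exp.2 ?_) (hρ _ hx').1 hr (Real.exp_pos _).le
    linarith [hx'.2]
  · refine Finset.sum_le_card_nsmul _ _ _ fun x hx => ?_
    have hx' := (hmem x).1 hx
    rw [hinv, mul_comm R]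
    refine mul_le_mul (Real.exp_le_exp.2 ?_) (hρ _ hx').2 (hr.trans (hρ _ hx').1)
      (Real.exp_pos _).le
    linarith [hx'.1]

lemma exists_increment_bounds (hH : ∀ x, 1 ≤ H x) (hfin : ∀ B : ℝ, {x : ι | H x ≤ B}.Finite)
    {ρ : ℝ → ℝ} (hρc : Continuous ρ) (hρ0 : 0 < ρ 0) (hc : 0 < c)
    (h : ∀ p q : ℝ, Tendsto (fun v : ℝ =>
      (∑' x, (H x)⁻¹ * (Ioc p q).indicator ρ (Real.log (H x) - v)) / v ^ t) atTop
      (𝓝 (c * ∫ w in Ioc p q, ρ w))) {κ : ℝ} (hκ : 1 < κ) :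
    ∃ δ > 0, δ ≤ Real.log κ ∧ ∀ᶠ v in atTop,
      c * δ / κ ^ 4 * (Real.exp v * v ^ t) ≤
        (Nat.card {x : ι // H x ≤ Real.exp v} : ℝ) - Nat.card {x : ι // H x ≤ Real.exp (v - δ)} ∧
      (Nat.card {x : ι // H x ≤ Real.exp v} : ℝ) - Nat.card {x : ι // H x ≤ Real.exp (v - δ)} ≤
        c * δ * κ ^ 4 * (Real.exp v * v ^ t) := by
  have hκ0 : 0 < κ := by linarith
  set r := ρ 0 with hr
  have hr1 : r / κ < r := div_lt_self hρ0 hκ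
  have hr2 : r < r * κ := lt_mul_of_one_lt_right hρ0 hκ
  have hnear : ∀ᶠ w in 𝓝 (0 : ℝ), r / κ < ρ w ∧ ρ w < r * κ :=
    ((hρc.tendsto 0).eventually (lt_mem_nhds hr1)).and
      ((hρc.tendsto 0).eventually (gt_mem_nhds hr2))
  obtain ⟨δ₀, hδ₀, hball⟩ := Metric.eventually_nhds_iff.1 hnear
  set δ := min (δ₀ / 2) (Real.log κ) with hδdef
  have hδ : 0 < δ := lt_min (by linarith) (Real.log_pos hκ)
  have hδκ : δ ≤ Real.log κ := min_le_right _ _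
  have hρb : ∀ w ∈ Ioc (-δ) 0, r / κ ≤ ρ w ∧ ρ w ≤ r * κ := fun w hw => by
    have h1 : δ ≤ δ₀ / 2 := min_le_left _ _
    have h2 := hball (y := w) (by
      rw [Real.dist_eq, sub_zero, abs_lt]
      constructor <;> linarith [hw.1, hw.2])
    exact ⟨h2.1.le, h2.2.le⟩
  have hint : IntegrableOn ρ (Ioc (-δ) 0) := hρc.integrableOn_Ioc
  have hvol : (volume : Measure ℝ).real (Ioc (-δ) 0) = δ := by
    rw [Real.volume_real_Ioc_of_le (by linarith)]; ring
  have hI1 : δ * (r / κ) ≤ ∫ w in Ioc (-δ) 0, ρ w := by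
    have := setIntegral_mono_on (integrableOn_const (by simp)) hint measurableSet_Ioc
      fun w hw => (hρb w hw).1
    rwa [setIntegral_const, hvol, smul_eq_mul] at this
  have hI2 : ∫ w in Ioc (-δ) 0, ρ w ≤ δ * (r * κ) := by
    have := setIntegral_mono_on hint (integrableOn_const (by simp)) measurableSet_Ioc
      fun w hw => (hρb w hw).2
    rwa [setIntegral_const, hvol, smul_eq_mul] at this
  have hexpδ : Real.exp δ ≤ κ := (Real.le_log_iff_exp_le hκ0).1 hδκ
  refine ⟨δ, hδ, hδκ, ?_⟩
  have hlow : c * δ * r / κ ^ 2 < c * ∫ w in Ioc (-δ) 0, ρ w := by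
    refine lt_of_lt_of_le ?_ (mul_le_mul_of_nonneg_left hI1 hc.le)
    rw [show c * (δ * (r / κ)) = c * δ * r / κ ^ 1 by rw [pow_one]; ring]
    exact div_lt_div_of_pos_left (by positivity) (by positivity)
      (pow_lt_pow_right₀ hκ (by norm_num))
  have hupp : c * ∫ w in Ioc (-δ) 0, ρ w < c * δ * r * κ ^ 2 := by
    refine lt_of_le_of_lt (mul_le_mul_of_nonneg_left hI2 hc.le) ?_
    rw [show c * (δ * (r * κ)) = c * δ * r * κ ^ 1 by rw [pow_one]; ring]
    exact mul_lt_mul_of_pos_left (pow_lt_pow_right₀ hκ (by norm_num)) (by positivity)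
  filter_upwards [(h (-δ) 0).eventually (lt_mem_nhds hlow),
    (h (-δ) 0).eventually (gt_mem_nhds hupp), eventually_gt_atTop 0] with v h1 h2 hv
  obtain ⟨h3, h4⟩ := card_sub_card_bounds hH hfin hδ.le (by positivity) hρb v
  have hD : 0 ≤ (Nat.card {x : ι // H x ≤ Real.exp v} : ℝ) -
      Nat.card {x : ι // H x ≤ Real.exp (v - δ)} :=
    sub_nonneg.2 (monotone_natCard hfin (by linarith))
  generalize (Nat.card {x : ι // H x ≤ Real.exp v} : ℝ) -
      Nat.card {x : ι // H x ≤ Real.exp (v - δ)} = D at h3 h4 hD ⊢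
  have hvt : 0 < v ^ t := pow_pos hv t
  rw [lt_div_iff₀ hvt] at h1
  rw [div_lt_iff₀ hvt] at h2
  have hev := Real.exp_pos v
  constructor
  · have h5 : c * δ * r / κ ^ 2 * v ^ t ≤ r * κ * (κ / Real.exp v) * D := by
      refine (h1.le.trans h4).trans ?_
      rw [Real.exp_sub]
      gcongr
    calc c * δ / κ ^ 4 * (Real.exp v * v ^ t)
        = Real.exp v / (r * κ ^ 2) * (c * δ * r / κ ^ 2 * v ^ t) := by field_simp
      _ ≤ Real.exp v / (r * κ ^ 2) * (r * κ * (κ / Real.exp v) * D) := by gcongr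
      _ = D := by field_simp
  · have h5 : r / κ * (1 / Real.exp v) * D ≤ c * δ * r * κ ^ 2 * v ^ t := by
      refine le_trans ?_ (h3.trans h2.le)
      rw [Real.exp_neg, one_div]
    calc D = κ * Real.exp v / r * (r / κ * (1 / Real.exp v) * D) := by field_simp
      _ ≤ κ * Real.exp v / r * (c * δ * r * κ ^ 2 * v ^ t) := by gcongr
      _ = c * δ * κ ^ 3 * (Real.exp v * v ^ t) := by field_simp
      _ ≤ c * δ * κ ^ 4 * (Real.exp v * v ^ t) := by
        gcongr
        · exact hκ.le
        · norm_num

end Counting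

/-- The Tauberian theorem in logarithmic scale. -/
theorem exists_pos_tendsto_natCard_div {ι : Type*} [Countable ι] {t : ℕ}
    {H : ι → ℝ} (hH : ∀ x, 1 ≤ H x)
    (hfin : ∀ B : ℝ, {x : ι | H x ≤ B}.Finite)
    (hconv : ∀ s : ℂ, 1 < s.re → Summable fun x : ι => ‖(H x : ℂ) ^ (-s)‖)
    {ε : ℝ} (hε : 0 < ε) {g : ℂ → ℂ} (hg : DifferentiableOn ℂ g {s : ℂ | 1 - ε < s.re})
    (hgζ : ∀ s : ℂ, 1 < s.re → g s = (s - 1) ^ (t + 1) * ∑' x : ι, (H x : ℂ) ^ (-s))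
    (hg1 : g 1 ≠ 0) :
    ∃ c : ℝ, 0 < c ∧ g 1 / t.factorial = c ∧
      Tendsto (fun v : ℝ => (Nat.card {x : ι // H x ≤ Real.exp v} : ℝ) / (Real.exp v * v ^ t))
        atTop (𝓝 c) := by
  obtain ⟨ρ, hρc, hρ, hρ0, hρi, hker⟩ := exists_nonneg_fourier_kernel
  have hρI : 0 < ∫ w, ρ w := integral_pos_of_integrable_nonneg_nonzero hρc hρi hρ hρ0.ne'
  have ha (x : ι) : 0 ≤ (H x)⁻¹ := inv_nonneg.2 (zero_le_one.trans (hH x))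
  have hsum (v : ℝ) : Summable fun x => (H x)⁻¹ * ρ (Real.log (H x) - v) := by
    obtain ⟨φ, hφ, hφρ⟩ := hker 0
    exact summable_inv_mul hH hconv hε hg hgζ φ hφ hρ (fun w => by simp [hφρ]) v
  have hlim (τ : ℝ) : Tendsto (fun v : ℝ => (∑' x, (((H x)⁻¹ : ℝ) : ℂ) *
      (Complex.exp (τ * ((Real.log (H x) - v : ℝ) : ℂ) * Complex.I) *
        ρ (Real.log (H x) - v))) / (v : ℂ) ^ t) atTop
      (𝓝 (g 1 / t.factorial * ∫ w : ℝ, Complex.exp (τ * (w : ℂ) * Complex.I) * (ρ w : ℂ))) := by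
    obtain ⟨φ, hφ, hφρ⟩ := hker τ
    have h1 := tendsto_tsum_inv_mul_fourier hH hconv hε hg hgζ φ hφ hsum fun w => by
      rw [hφρ, norm_mul, ← Complex.ofReal_mul, Complex.norm_exp_ofReal_mul_I, one_mul,
        Complex.norm_real, Real.norm_of_nonneg (hρ w)]
    simpa only [hφρ] using h1
  obtain ⟨c, hc, hgc⟩ := exists_pos_ofReal_eq (t := t) (ℓ := fun x => Real.log (H x)) ha hρ hρI
    (div_ne_zero hg1 (Nat.cast_ne_zero.2 t.factorial_ne_zero)) (by simpa using hlim 0)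
  rw [hgc] at hlim
  have h := tendsto_tsum_indicator ha hρc hρ hρi hρI hsum hc hlim
  exact ⟨c, hc, hgc, tendsto_div_of_increments (monotone_natCard hfin)
    (fun v => Nat.cast_nonneg _) hc
    fun κ hκ => exists_increment_bounds hH hfin hρc hρ0 hc h hκ⟩

end Delange

/-- **Tauberian theorem** (Delange): if the height zeta function `ζ(s) = Σ_x H(x)^{-s}`
converges absolutely for `Re s > 1` and `(s-1)^t ζ(s)` extends holomorphically past
`Re s = 1` with nonzero value `g 1` at `s = 1`, then the number `n(B)` of points of
height at most `B` satisfies `n(B) ∼ (g 1 / (t-1)!) ⬝ B (log B)^{t-1}` as `B → ∞`. -/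
theorem statement13 {ι : Type*} [Countable ι] (t : ℕ) (ht : 1 ≤ t)
    (H : ι → ℝ) (hH : ∀ x, 1 ≤ H x)
    (hfin : ∀ B : ℝ, {x : ι | H x ≤ B}.Finite)
    (hconv : ∀ s : ℂ, 1 < s.re → Summable fun x : ι => ‖(H x : ℂ) ^ (-s)‖)
    (ε : ℝ) (hε : 0 < ε) (g : ℂ → ℂ)
    (hg : DifferentiableOn ℂ g {s : ℂ | 1 - ε < s.re})
    (hgζ : ∀ s : ℂ, 1 < s.re → g s = (s - 1) ^ t * ∑' x : ι, (H x : ℂ) ^ (-s))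
    (hg1 : g 1 ≠ 0) :
    (fun B : ℝ => (Nat.card {x : ι // H x ≤ B} : ℂ)) ~[atTop]
      (fun B : ℝ => g 1 / (Nat.factorial (t - 1) : ℂ) * (B : ℂ) * (Real.log B : ℂ) ^ (t - 1)) := by
  obtain ⟨t, rfl⟩ : ∃ m, t = m + 1 := ⟨t - 1, by omega⟩
  rw [Nat.add_sub_cancel]
  obtain ⟨c, hc, hgc, h⟩ :=
    Delange.exists_pos_tendsto_natCard_div hH hfin hconv hε hg hgζ hg1
  rw [hgc]
  refine isEquivalent_of_tendsto_one ?_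
  have h1 := (Complex.continuous_ofReal.tendsto _).comp
    ((h.comp Real.tendsto_log_atTop).div_const c)
  rw [div_self hc.ne', Complex.ofReal_one] at h1
  refine h1.congr' ?_
  filter_upwards [eventually_gt_atTop 1] with B hB
  have hB0 : 0 < B := by linarith
  simp only [Function.comp_apply, Pi.div_apply, Real.exp_log hB0]
  push_cast
  rw [div_div]
  congr 1
  ring
end
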